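/- arXiv:2301.09970 — 2 statements merged into one kernel-verified Lean document; each statement's English description precedes it below -/
import Mathlib

section
/- Let D be an almost Dedekind domain. Then the set Max(D) \ Crit(D) of noncritical maximal ideals is dense in Max(D) with respect to the constructible topology. -/
/-!
Common definitions: almost Dedekind domains, ideal functions, critical ideals,
the constructible topology on the maximal spectrum.
-/

open scoped Classical Topology

namespace ADPaper

variable (R : Type*) [CommRing R]

/-- The normalized valuation `v_M(x)` of an element `x` of `R` in the localization at the
maximal ideal `M`: the largest `n` such that the image of `x` lies in the `n`-th power of the
maximal ideal of `R_M` (a junk value if no largest such `n` exists). -/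
noncomputable def elemVal (M : MaximalSpectrum R) (x : R) : ℕ :=
  sSup {n : ℕ | algebraMap R (Localization.AtPrime M.asIdeal) x ∈
    IsLocalRing.maximalIdeal (Localization.AtPrime M.asIdeal) ^ n}

/-- The ideal function `ν_I(M) = v_M(I) = min { v_M(x) : x ∈ I, x ≠ 0 }`. -/
noncomputable def nu (I : Ideal R) (M : MaximalSpectrum R) : ℕ :=
  sInf (elemVal R M '' {x | x ∈ I ∧ x ≠ 0})

/-- `R` is an almost Dedekind domain: the localization at every maximal ideal is a
discrete valuation ring. (The requirement that `R` is not a field is stated separately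
where needed.) -/
def AlmostDedekind [IsDomain R] : Prop :=
  ∀ M : MaximalSpectrum R, IsDiscreteValuationRing (Localization.AtPrime M.asIdeal)

/-- An ideal `M` of a commutative ring is critical if it is maximal and contains no nonzero
finitely generated radical ideal. -/
def IsCritical (M : Ideal R) : Prop :=
  M.IsMaximal ∧ ∀ J : Ideal R, J ≠ ⊥ → J.FG → J.IsRadical → ¬ J ≤ M

/-- `Crit R`: the set of critical maximal ideals, i.e. maximal ideals containing no
nonzero finitely generated radical ideal. -/
def Crit : Set (MaximalSpectrum R) :=
  {M | ∀ J : Ideal R, J ≠ ⊥ → J.FG → J.IsRadical → ¬ J ≤ M.asIdeal}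

/-- `CritN R n`: the set of `n`-critical maximal ideals, i.e. maximal ideals containing no
nonzero finitely generated ideal whose ideal function is bounded by `n`. -/
def CritN (n : ℕ) : Set (MaximalSpectrum R) :=
  {M | ∀ J : Ideal R, J ≠ ⊥ → J.FG → (∀ N, nu R J N ≤ n) → ¬ J ≤ M.asIdeal}

/-- `CritOmega R`: the set of `ω`-critical maximal ideals, i.e. maximal ideals containing no
nonzero finitely generated ideal whose ideal function is bounded. -/
def CritOmega : Set (MaximalSpectrum R) :=
  {M | ∀ J : Ideal R, J ≠ ⊥ → J.FG → (∃ n : ℕ, ∀ N, nu R J N ≤ n) → ¬ J ≤ M.asIdeal}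

/-- The constructible topology on the maximal spectrum: generated by the sets
`V(J) = {M | J ≤ M}` and their complements, for `J` finitely generated. -/
def constrTop : TopologicalSpace (MaximalSpectrum R) :=
  TopologicalSpace.generateFrom
    {S | ∃ J : Ideal R, J.FG ∧ (S = {M | J ≤ M.asIdeal} ∨ S = {M | ¬ J ≤ M.asIdeal})}

variable [IsDomain R]

/-- The localization `R_M` regarded as a subalgebra of the fraction field. -/
noncomputable def locSubalgebra (M : MaximalSpectrum R) : Subalgebra R (FractionRing R) :=
  Localization.subalgebra (FractionRing R) M.asIdeal.primeCompl
    (fun _s hs => mem_nonZeroDivisors_of_ne_zero fun h => hs (h ▸ M.asIdeal.zero_mem))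

/-- The overring `⋂ {R_M : M ∈ X}` of `R` inside the fraction field (equal to the whole
fraction field when `X = ∅`). -/
noncomputable def interLoc (X : Set (MaximalSpectrum R)) : Subalgebra R (FractionRing R) :=
  ⨅ M ∈ X, locSubalgebra R M

/-- The valuation `v_M` extended to the fraction field: `v_M(a/s) = v_M(a) - v_M(s)`. -/
noncomputable def elemValK (M : MaximalSpectrum R) (x : FractionRing R) : ℤ :=
  (elemVal R M (IsLocalization.sec (nonZeroDivisors R) x).1 : ℤ) -
    (elemVal R M ((IsLocalization.sec (nonZeroDivisors R) x).2 : R) : ℤ)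

/-- The ideal function of a fractional ideal. -/
noncomputable def nuK (I : FractionalIdeal (nonZeroDivisors R) (FractionRing R))
    (M : MaximalSpectrum R) : ℤ :=
  sInf (elemValK R M '' {x | x ∈ I ∧ x ≠ 0})

end ADPaper

namespace ADPaper

/-- Powers of a maximal ideal are primary, so factors outside the ideal can be cancelled. -/
lemma mem_pow_of_mul_mem_pow {R : Type*} [CommRing R] {M : Ideal R} (hM : M.IsMaximal)
    {n : ℕ} {s x : R} (hs : s ∉ M) (h : s * x ∈ M ^ n) : x ∈ M ^ n := by
  obtain ⟨t, m, hm, hts⟩ := Ideal.IsMaximal.exists_inv hM hs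
  have hcop : IsCoprime (Ideal.span {s}) M :=
    Ideal.isCoprime_iff_exists.2
      ⟨t * s, Ideal.mul_mem_left _ _ (Ideal.mem_span_singleton_self s), m, hm, hts⟩
  obtain ⟨a, ha, b, hb, hab⟩ := Ideal.isCoprime_iff_exists.1 (hcop.pow_right (n := n))
  obtain ⟨c, rfl⟩ := Ideal.mem_span_singleton'.1 ha
  have hx : x = c * (s * x) + x * b := by linear_combination (-x) * hab
  rw [hx]
  exact add_mem (Ideal.mul_mem_left _ _ h) (Ideal.mul_mem_left _ _ hb)

/-- If `s ∉ M`, then `s` avoids all maximal ideals containing some fixed element of `M`. -/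
lemma exists_mem_forall_notMem {R : Type*} [CommRing R] {M : Ideal R} (hM : M.IsMaximal)
    {s : R} (hs : s ∉ M) : ∃ t ∈ M, ∀ N : MaximalSpectrum R, t ∈ N.asIdeal → s ∉ N.asIdeal := by
  obtain ⟨t, m, hm, hts⟩ := Ideal.IsMaximal.exists_inv hM hs
  refine ⟨m, hm, fun N hN hsN => N.isMaximal.ne_top ((Ideal.eq_top_iff_one _).2 ?_)⟩
  rw [← hts]
  exact add_mem (Ideal.mul_mem_left _ _ hsN) hN

/-- A maximal ideal whose localization is a discrete valuation ring has a local uniformizer. -/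
lemma exists_local_uniformizer {R : Type*} [CommRing R] [IsDomain R] (M : MaximalSpectrum R)
    (h : IsDiscreteValuationRing (Localization.AtPrime M.asIdeal)) :
    ∃ m ∈ M.asIdeal, ∀ (n : ℕ) (x : R), x ∈ M.asIdeal ^ n →
      ∃ s ∉ M.asIdeal, ∃ r, s * x = m ^ n * r := by
  obtain ⟨p, hp⟩ := IsDiscreteValuationRing.exists_irreducible (Localization.AtPrime M.asIdeal)
  have hpm := hp.maximalIdeal_eq
  obtain ⟨⟨m, s⟩, hms⟩ := IsLocalization.surj M.asIdeal.primeCompl p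
  have hunit : IsUnit (algebraMap R (Localization.AtPrime M.asIdeal) s) :=
    IsLocalization.map_units _ s
  have hspan : IsLocalRing.maximalIdeal (Localization.AtPrime M.asIdeal) =
      Ideal.span {algebraMap R (Localization.AtPrime M.asIdeal) m} := by
    rw [hpm, ← hms, Ideal.span_singleton_mul_right_unit hunit]
  refine ⟨m, ?_, fun n x hx => ?_⟩
  · rw [← IsLocalization.AtPrime.to_map_mem_maximal_iff (Localization.AtPrime M.asIdeal)
      M.asIdeal, hspan]
    exact Ideal.mem_span_singleton_self _
  · have hx' := Ideal.mem_map_of_mem (algebraMap R (Localization.AtPrime M.asIdeal)) hx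
    rw [Ideal.map_pow, Localization.AtPrime.map_eq_maximalIdeal, hspan,
      Ideal.span_singleton_pow, Ideal.mem_span_singleton] at hx'
    obtain ⟨q, hq⟩ := hx'
    obtain ⟨⟨r, u⟩, hru⟩ := IsLocalization.surj M.asIdeal.primeCompl q
    refine ⟨u, u.2, r, IsLocalization.injective (Localization.AtPrime M.asIdeal)
      M.asIdeal.primeCompl_le_nonZeroDivisors ?_⟩
    simp only [map_mul, map_pow] at hru ⊢
    rw [hq, ← hru]
    ring

/-- A nonzero element lies in only finitely many powers of a maximal ideal whose localization is
a discrete valuation ring. -/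
lemma exists_notMem_pow {R : Type*} [CommRing R] [IsDomain R] (M : MaximalSpectrum R)
    (h : IsDiscreteValuationRing (Localization.AtPrime M.asIdeal)) {x : R} (hx : x ≠ 0) :
    ∃ n : ℕ, x ∉ M.asIdeal ^ n := by
  by_contra! hall
  refine hx (IsLocalization.injective (Localization.AtPrime M.asIdeal)
    M.asIdeal.primeCompl_le_nonZeroDivisors ?_)
  rw [map_zero, ← Ideal.mem_bot, ← Ideal.iInf_pow_eq_bot_of_isLocalRing
    (IsLocalRing.maximalIdeal (Localization.AtPrime M.asIdeal))
    (IsLocalRing.maximalIdeal.isMaximal _).ne_top, Ideal.mem_iInf]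
  intro n
  have hn := Ideal.mem_map_of_mem (algebraMap R (Localization.AtPrime M.asIdeal)) (hall n)
  rwa [Ideal.map_pow, Localization.AtPrime.map_eq_maximalIdeal] at hn

/-- An element of `N` outside `N ^ 2` is a local generator of `N`. -/
lemma exists_mul_mem_span_singleton {R : Type*} [CommRing R] [IsDomain R]
    (N : MaximalSpectrum R) (h : IsDiscreteValuationRing (Localization.AtPrime N.asIdeal))
    {m y : R} (hm : m ∈ N.asIdeal) (hm2 : m ∉ N.asIdeal ^ 2) (hy : y ∈ N.asIdeal) :
    ∃ u ∉ N.asIdeal, u * y ∈ Ideal.span {m} := by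
  obtain ⟨p, hp, hpn⟩ := exists_local_uniformizer N h
  obtain ⟨s, hs, r, hsr⟩ := hpn 1 m (by simpa using hm)
  obtain ⟨s', hs', r', hsr'⟩ := hpn 1 y (by simpa using hy)
  have hr : r ∉ N.asIdeal := fun hr => hm2 <| mem_pow_of_mul_mem_pow N.isMaximal hs <| by
    rw [hsr, pow_one, pow_two]
    exact Ideal.mul_mem_mul hp hr
  refine ⟨r * s', N.isMaximal.isPrime.mul_notMem hr hs', Ideal.mem_span_singleton'.2
    ⟨s * r', ?_⟩⟩
  linear_combination r' * hsr - r * hsr'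

/-- An ideal containing an element which has order one at every maximal ideal above that ideal
is radical. -/
lemma isRadical_of_mem_of_notMem_sq {R : Type*} [CommRing R] [IsDomain R]
    (hAD : AlmostDedekind R) {L : Ideal R} {m : R} (hm : m ∈ L)
    (h : ∀ N : MaximalSpectrum R, L ≤ N.asIdeal → m ∉ N.asIdeal ^ 2) : L.IsRadical := by
  rintro y ⟨k, hk⟩
  have htop : L.colon {y} = ⊤ := by
    by_contra hne
    obtain ⟨N, hN, hle⟩ := Ideal.exists_le_maximal _ hne
    by_cases hLN : L ≤ N
    · obtain ⟨u, hu, huy⟩ := exists_mul_mem_span_singleton ⟨N, hN⟩ (hAD ⟨N, hN⟩) (hLN hm)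
        (h ⟨N, hN⟩ hLN) (hN.isPrime.mem_of_pow_mem k (hLN hk))
      exact hu (hle (Submodule.mem_colon_singleton.2
        ((Ideal.span_singleton_le_iff_mem L).2 hm huy)))
    · exact hLN fun z hz => hle (Submodule.mem_colon_singleton.2 (L.mul_mem_right y hz))
  have h1 : (1 : R) ∈ L.colon {y} := htop ▸ Submodule.mem_top
  simpa using Submodule.mem_colon_singleton.1 h1

/-- If `x` has the same positive order at all maximal ideals above `K`, then each of these is
noncritical. -/
lemma notMem_crit_of_constant_order {R : Type*} [CommRing R] [IsDomain R]
    (hAD : AlmostDedekind R) {K : Ideal R} (hK : K.FG) {x : R} (hx : x ≠ 0) (hxK : x ∈ K)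
    {n : ℕ} (hn : 1 ≤ n) (h : ∀ N : MaximalSpectrum R, K ≤ N.asIdeal →
      x ∈ N.asIdeal ^ n ∧ x ∉ N.asIdeal ^ (n + 1))
    (M : MaximalSpectrum R) (hKM : K ≤ M.asIdeal) : M ∉ Crit R := by
  obtain ⟨m, hm, hmn⟩ := exists_local_uniformizer M (hAD M)
  obtain ⟨s, hs, r, hsr⟩ := hmn n x (h M hKM).1
  obtain ⟨t, ht, hts⟩ := exists_mem_forall_notMem M.isMaximal hs
  have hmL : m ∈ K ⊔ Ideal.span {m, t} := Ideal.mem_sup_right (Ideal.subset_span (by simp))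
  have htL : t ∈ K ⊔ Ideal.span {m, t} := Ideal.mem_sup_right (Ideal.subset_span (by simp))
  have hxL : x ∈ K ⊔ Ideal.span {m, t} := Ideal.mem_sup_left hxK
  intro hcrit
  refine hcrit (K ⊔ Ideal.span {m, t}) (fun hbot => hx ?_)
    (Submodule.FG.sup hK ⟨{m, t}, by simp⟩)
    (isRadical_of_mem_of_notMem_sq hAD hmL fun N hN hm2 => ?_) (sup_le hKM (Ideal.span_le.2 ?_))
  · rwa [hbot, Ideal.mem_bot] at hxL
  · refine (h N (le_sup_left.trans hN)).2
      (mem_pow_of_mul_mem_pow N.isMaximal (hts N (hN htL)) ?_)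
    rw [hsr]
    refine Ideal.mul_mem_right _ _ (Ideal.pow_le_pow_right (show n + 1 ≤ 2 * n by omega) ?_)
    rw [pow_mul]
    exact Ideal.pow_mem_pow hm2 n
  · rintro z (rfl | rfl) <;> assumption

/-- The condition `x ∈ M ^ n` holds on a basic closed neighbourhood of `M`. -/
lemma exists_fg_forall_mem_pow {R : Type*} [CommRing R] [IsDomain R]
    (hAD : AlmostDedekind R) {K : Ideal R} (hK : K.FG) (M : MaximalSpectrum R)
    (hKM : K ≤ M.asIdeal) {x : R} {n : ℕ} (hx : x ∈ M.asIdeal ^ n) :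
    ∃ L : Ideal R, L.FG ∧ K ≤ L ∧ L ≤ M.asIdeal ∧
      ∀ N : MaximalSpectrum R, L ≤ N.asIdeal → x ∈ N.asIdeal ^ n := by
  obtain ⟨m, hm, hmn⟩ := exists_local_uniformizer M (hAD M)
  obtain ⟨s, hs, r, hsr⟩ := hmn n x hx
  obtain ⟨t, ht, hts⟩ := exists_mem_forall_notMem M.isMaximal hs
  refine ⟨K ⊔ Ideal.span {m, t}, Submodule.FG.sup hK ⟨{m, t}, by simp⟩, le_sup_left,
    sup_le hKM (Ideal.span_le.2 ?_), fun N hN => ?_⟩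
  · rintro z (rfl | rfl) <;> assumption
  · have hmN : m ∈ N.asIdeal := hN (Ideal.mem_sup_right (Ideal.subset_span (by simp)))
    have htN : t ∈ N.asIdeal := hN (Ideal.mem_sup_right (Ideal.subset_span (by simp)))
    refine mem_pow_of_mul_mem_pow N.isMaximal (hts N htN) ?_
    rw [hsr]
    exact Ideal.mul_mem_right _ _ (Ideal.pow_mem_pow hmN n)

/-- Every proper nonzero finitely generated ideal lies in a noncritical maximal ideal. -/
lemma exists_notMem_crit_of_fg {R : Type*} [CommRing R] [IsDomain R]
    (hAD : AlmostDedekind R) {J : Ideal R} (hJ : J.FG) (hbot : J ≠ ⊥) (htop : J ≠ ⊤) :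
    ∃ M : MaximalSpectrum R, J ≤ M.asIdeal ∧ M ∉ Crit R := by
  obtain ⟨x, hxJ, hx⟩ := Submodule.exists_mem_ne_zero_of_ne_bot hbot
  by_contra! hcrit
  let P : ℕ → Ideal R → Prop := fun n K => K.FG ∧ J ≤ K ∧ K ≠ ⊤ ∧
    ∀ N : MaximalSpectrum R, K ≤ N.asIdeal → x ∈ N.asIdeal ^ (n + 1)
  have step : ∀ (n : ℕ) (K : Ideal R), P n K → ∃ L, K ≤ L ∧ P (n + 1) L := by
    rintro n K ⟨hK, hJK, hKtop, hKx⟩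
    by_cases hex : ∃ N : MaximalSpectrum R, K ≤ N.asIdeal ∧ x ∈ N.asIdeal ^ (n + 1 + 1)
    · obtain ⟨N, hKN, hxN⟩ := hex
      obtain ⟨L, hL, hKL, hLN, hLx⟩ := exists_fg_forall_mem_pow hAD hK N hKN hxN
      exact ⟨L, hKL, hL, hJK.trans hKL, fun h => N.isMaximal.ne_top (top_le_iff.1 (h ▸ hLN)),
        hLx⟩
    · push Not at hex
      obtain ⟨M, hM, hKM⟩ := Ideal.exists_le_maximal K hKtop
      exact absurd (hcrit ⟨M, hM⟩ (hJK.trans hKM))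
        (notMem_crit_of_constant_order hAD hK hx (hJK hxJ) (Nat.le_add_left 1 n)
          (fun N hN => ⟨hKx N hN, hex N hN⟩) ⟨M, hM⟩ hKM)
  have base : P 0 J := ⟨hJ, le_rfl, htop, fun N hN => by simpa using hN hxJ⟩
  choose next hle hnext using step
  let chain : (n : ℕ) → {K : Ideal R // P n K} := fun n =>
    Nat.rec ⟨J, base⟩ (fun k K => ⟨next k K.1 K.2, hnext k K.1 K.2⟩) n
  have hmono : Monotone fun n => (chain n).1 :=
    monotone_nat_of_le_succ fun n => hle n (chain n).1 (chain n).2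
  have hsup : (⨆ n, (chain n).1) ≠ ⊤ := by
    intro h
    have h1 : (1 : R) ∈ ⨆ n, (chain n).1 := h ▸ Submodule.mem_top
    obtain ⟨n, hn⟩ := (Submodule.mem_iSup_of_directed _ hmono.directed_le).1 h1
    exact (chain n).2.2.2.1 ((Ideal.eq_top_iff_one _).2 hn)
  obtain ⟨N, hN, hle'⟩ := Ideal.exists_le_maximal _ hsup
  obtain ⟨n, hn⟩ := exists_notMem_pow ⟨N, hN⟩ (hAD ⟨N, hN⟩) hx
  exact hn (Ideal.pow_le_pow_right n.le_succ
    ((chain n).2.2.2.2 ⟨N, hN⟩ ((le_iSup (fun n => (chain n).1) n).trans hle')))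

/-- The sets `V(J)` with `J` finitely generated form neighbourhood bases for the constructible
topology on the maximal spectrum. -/
lemma exists_fg_subset_of_isOpen {R : Type*} [CommRing R] {U : Set (MaximalSpectrum R)}
    (hU : IsOpen[constrTop R] U) {M : MaximalSpectrum R} (hM : M ∈ U) :
    ∃ J : Ideal R, J.FG ∧ J ≤ M.asIdeal ∧ {N : MaximalSpectrum R | J ≤ N.asIdeal} ⊆ U := by
  induction hU with
  | basic S hS =>
    obtain ⟨J, hJ, rfl | rfl⟩ := hS
    · exact ⟨J, hJ, hM, subset_rfl⟩
    · obtain ⟨s, hsJ, hs⟩ := SetLike.not_le_iff_exists.1 hM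
      obtain ⟨t, ht, hts⟩ := exists_mem_forall_notMem M.isMaximal hs
      exact ⟨Ideal.span {t}, ⟨{t}, by simp⟩, (Ideal.span_singleton_le_iff_mem _).2 ht,
        fun N hN hJN => hts N ((Ideal.span_singleton_le_iff_mem _).1 hN) (hJN hsJ)⟩
  | univ => exact ⟨⊥, Submodule.fg_bot, bot_le, Set.subset_univ _⟩
  | inter A B _ _ ihA ihB =>
    obtain ⟨I, hI, hIM, hIA⟩ := ihA hM.1
    obtain ⟨J, hJ, hJM, hJB⟩ := ihB hM.2
    exact ⟨I ⊔ J, Submodule.FG.sup hI hJ, sup_le hIM hJM,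
      fun N (hN : I ⊔ J ≤ N.asIdeal) =>
        ⟨hIA (show I ≤ N.asIdeal from le_sup_left.trans hN),
          hJB (show J ≤ N.asIdeal from le_sup_right.trans hN)⟩⟩
  | sUnion C _ ih =>
    obtain ⟨A, hA, hMA⟩ := hM
    obtain ⟨J, hJ, hJM, hJA⟩ := ih A hA hMA
    exact ⟨J, hJ, hJM, hJA.trans (Set.subset_sUnion_of_mem hA)⟩

/-- For every almost Dedekind domain `D`, the set `Max(D) \ Crit(D)` of
noncritical maximal ideals is dense in `Max(D)` with the constructible topology. -/
theorem statement18 (R : Type*) [CommRing R] [IsDomain R] (hAD : AlmostDedekind R) :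
    @Dense (MaximalSpectrum R) (constrTop R) ((Crit R)ᶜ) := by
  let := constrTop R
  refine dense_iff_inter_open.2 fun U hU ⟨M, hM⟩ => ?_
  obtain ⟨J, hJ, hJM, hJU⟩ := exists_fg_subset_of_isOpen hU hM
  have hMbot : M.asIdeal ≠ ⊥ := by
    intro hbot
    have := hAD M
    refine IsDiscreteValuationRing.not_a_field (Localization.AtPrime M.asIdeal) ?_
    rw [← Localization.AtPrime.map_eq_maximalIdeal, Ideal.map_eq_bot_iff_le_ker]
    exact hbot.le.trans bot_le
  obtain ⟨x, hxM, hx⟩ := Submodule.exists_mem_ne_zero_of_ne_bot hMbot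
  have hle : J ⊔ Ideal.span {x} ≤ M.asIdeal :=
    sup_le hJM ((Ideal.span_singleton_le_iff_mem _).2 hxM)
  obtain ⟨N, hJN, hN⟩ := exists_notMem_crit_of_fg hAD (J := J ⊔ Ideal.span {x})
    (Submodule.FG.sup hJ ⟨{x}, by simp⟩)
    (fun h => hx ((Submodule.eq_bot_iff _).1 h x
      (Ideal.mem_sup_right (Ideal.mem_span_singleton_self x))))
    (fun h => M.isMaximal.ne_top (top_le_iff.1 (h ▸ hle)))
  exact ⟨N, hJU (le_sup_left.trans hJN), hN⟩

end ADPaper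
end

section
/- Let D be an almost Dedekind domain. Then the group Inv(D) of invertible fractional ideals of D is a free abelian group. -/
/-!
Common definitions: almost Dedekind domains, ideal functions, critical ideals,
the constructible topology on the maximal spectrum.
-/

open scoped Classical Topology

namespace ADPaper

/-- A group `G` of integer-valued functions that is closed under pointwise minima, attains the
value `1` at every point, separates points, and whose supports are compact, in the sense that every
downward directed family of nonzero nonnegative functions in `G` has a common support point. -/
structure IsCompactIntLattice {X : Type*} (G : Submodule ℤ (X → ℤ)) : Prop where
  inf_mem : ∀ f ∈ G, ∀ g ∈ G, f ⊓ g ∈ G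
  exists_eq_one : ∀ x, ∃ f ∈ G, f x = 1
  separates : ∀ x y, x ≠ y → ∃ f ∈ G, f x ≠ 0 ∧ f y = 0
  exists_common : ∀ S : Set (X → ℤ), S ⊆ G → S.Nonempty → DirectedOn (· ≥ ·) S →
    (∀ f ∈ S, 0 ≤ f ∧ f ≠ 0) → ∃ x, ∀ f ∈ S, f x ≠ 0

namespace IsCompactIntLattice

universe u

variable {X : Type u} {G : Submodule ℤ (X → ℤ)}

lemma sup_mem (hG : IsCompactIntLattice G) {f g : X → ℤ} (hf : f ∈ G) (hg : g ∈ G) :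
    f ⊔ g ∈ G := by
  have h := G.neg_mem (hG.inf_mem _ (G.neg_mem hf) _ (G.neg_mem hg))
  rwa [neg_inf, neg_neg, neg_neg] at h

lemma abs_mem (hG : IsCompactIntLattice G) {f : X → ℤ} (hf : f ∈ G) : |f| ∈ G :=
  hG.sup_mem hf (G.neg_mem hf)

lemma posPart_mem (hG : IsCompactIntLattice G) {f : X → ℤ} (hf : f ∈ G) : f ⊔ 0 ∈ G :=
  hG.sup_mem hf G.zero_mem

/-- On the support of `a`, every element of `G` is bounded by a multiple of `a`. -/
lemma exists_le_mul (hG : IsCompactIntLattice G) {a g : X → ℤ} (ha : a ∈ G) (hg : g ∈ G)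
    (ha0 : 0 ≤ a) : ∃ n : ℕ, ∀ x, a x ≠ 0 → g x ≤ n * a x := by
  by_contra! hcon
  obtain ⟨x, hx⟩ := hG.exists_common
    (Set.range fun n : ℕ => a ⊓ ((g - (n : ℤ) • a) ⊔ 0))
    (by
      rintro _ ⟨n, rfl⟩
      exact hG.inf_mem _ ha _ (hG.posPart_mem (G.sub_mem hg (G.smul_mem _ ha))))
    (Set.range_nonempty _)
    (by
      have : Antitone fun n : ℕ => a ⊓ ((g - (n : ℤ) • a) ⊔ 0) := by
        intro m n hmn x
        have h1 : (m : ℤ) ≤ n := by exact_mod_cast hmn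
        have h2 := mul_le_mul_of_nonneg_right h1 (ha0 x)
        simp only [Pi.inf_apply, Pi.sup_apply, Pi.sub_apply, Pi.smul_apply, smul_eq_mul]
        gcongr
      rintro _ ⟨m, rfl⟩ _ ⟨n, rfl⟩
      exact ⟨_, ⟨max m n, rfl⟩, this (le_max_left _ _), this (le_max_right _ _)⟩)
    (by
      rintro _ ⟨n, rfl⟩
      refine ⟨le_inf ha0 le_sup_right, fun h => ?_⟩
      obtain ⟨x, hx, hlt⟩ := hcon n
      have h0 := congr_fun h x
      have := ha0 x
      simp only [Pi.inf_apply, Pi.sup_apply, Pi.sub_apply, Pi.smul_apply, smul_eq_mul,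
        Pi.zero_apply] at h0 this
      omega)
  have hx' : ∀ n : ℕ, a x ≠ 0 ∧ (n : ℤ) * a x < g x := by
    intro n
    have h0 := hx _ ⟨n, rfl⟩
    have := ha0 x
    simp only [Pi.inf_apply, Pi.sup_apply, Pi.sub_apply, Pi.smul_apply, smul_eq_mul,
        Pi.zero_apply] at h0 this
    constructor
    · rintro h
      simp [h] at h0
    · omega
  obtain ⟨h1, h2⟩ := hx' (g x).toNat
  have h3 : 1 ≤ a x := by have := ha0 x; simp only [Pi.zero_apply] at this; omega
  have h4 : g x ≤ (g x).toNat := Int.self_le_toNat _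
  nlinarith

/-- A nonnegative function in `G` can be cut off to zero on the support of another one. -/
lemma exists_cutoff (hG : IsCompactIntLattice G) {a g : X → ℤ} (ha : a ∈ G) (hg : g ∈ G)
    (hg0 : 0 ≤ g) : ∃ w ∈ G, 0 ≤ w ∧ w ≤ g ∧ (∀ x, a x ≠ 0 → w x = 0) ∧
      ∀ x, a x = 0 → w x = g x := by
  obtain ⟨n, hn⟩ := hG.exists_le_mul (hG.abs_mem ha) hg (abs_nonneg a)
  refine ⟨(g - (n : ℤ) • |a|) ⊔ 0,
    hG.posPart_mem (G.sub_mem hg (G.smul_mem _ (hG.abs_mem ha))), le_sup_right, ?_, ?_, ?_⟩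
  · refine sup_le (sub_le_self _ ?_) hg0
    exact smul_nonneg (by positivity) (abs_nonneg a)
  · intro x hx
    have := hn x (by simpa using hx)
    simpa using this
  · intro x hx
    simpa [hx] using hg0 x

/-- An element of `G` vanishing at all common zeros of a solid subgroup belongs to it. -/
lemma mem_of_forall_eq_zero (hG : IsCompactIntLattice G) {H : Submodule ℤ (X → ℤ)} (hHG : H ≤ G)
    (hH : ∀ g ∈ G, ∀ h ∈ H, |g| ≤ |h| → g ∈ H) {g : X → ℤ} (hg : g ∈ G)
    (hg0 : ∀ x, (∀ h ∈ H, h x = 0) → g x = 0) : g ∈ H := by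
  have habs : ∀ h ∈ H, |h| ∈ H := fun h hh => hH _ (hG.abs_mem (hHG hh)) h hh (by simp)
  by_contra hgH
  obtain ⟨x, hx⟩ := hG.exists_common {k | ∃ h ∈ H, 0 ≤ h ∧ k = (|g| - h) ⊔ 0}
    (by
      rintro _ ⟨h, hh, -, rfl⟩
      exact hG.posPart_mem (G.sub_mem (hG.abs_mem hg) (hHG hh)))
    ⟨_, 0, H.zero_mem, le_rfl, rfl⟩
    (by
      rintro _ ⟨h, hh, h0, rfl⟩ _ ⟨k, hk, k0, rfl⟩
      refine ⟨_, ⟨h + k, H.add_mem hh hk, add_nonneg h0 k0, rfl⟩, ?_, ?_⟩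
      · exact sup_le_sup_right (sub_le_sub_left (le_add_of_nonneg_right k0) _) _
      · exact sup_le_sup_right (sub_le_sub_left (le_add_of_nonneg_left h0) _) _)
    (by
      rintro _ ⟨h, hh, h0, rfl⟩
      refine ⟨le_sup_right, fun heq => hgH (hH g hg h hh ?_)⟩
      rw [sup_eq_right, sub_nonpos] at heq
      exact heq.trans (le_abs_self h))
  have key : ∀ h ∈ H, 0 ≤ h → h x < |g x| := by
    intro h hh h0
    have := hx _ ⟨h, hh, h0, rfl⟩
    simp only [Pi.sup_apply, Pi.sub_apply, Pi.abs_apply, Pi.zero_apply] at this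
    omega
  have hgx : g x = 0 := by
    refine hg0 x fun h hh => ?_
    by_contra hne
    have h1 := key ((|g x|) • |h|) (H.smul_mem _ (habs h hh))
      (smul_nonneg (abs_nonneg _) (abs_nonneg h))
    simp only [Pi.smul_apply, Pi.abs_apply, smul_eq_mul] at h1
    have h2 : 1 ≤ |h x| := Int.one_le_abs hne
    nlinarith [abs_nonneg (g x)]
  simpa [hgx] using key 0 H.zero_mem le_rfl

/-- Restriction of functions to a subset. -/
abbrev restr (Y : Set X) : (X → ℤ) →ₗ[ℤ] (Y → ℤ) := LinearMap.funLeft ℤ ℤ ((↑) : Y → X)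

/-- Restriction to the zero set of a subgroup. -/
lemma map_restr (hG : IsCompactIntLattice G) {H : Submodule ℤ (X → ℤ)} (hHG : H ≤ G) :
    IsCompactIntLattice (G.map (restr {x | ∀ h ∈ H, h x = 0})) where
  inf_mem := by
    rintro _ ⟨f, hf, rfl⟩ _ ⟨g, hg, rfl⟩
    exact ⟨f ⊓ g, hG.inf_mem f hf g hg, rfl⟩
  exists_eq_one x := by
    obtain ⟨f, hf, h⟩ := hG.exists_eq_one x
    exact ⟨_, ⟨f, hf, rfl⟩, h⟩
  separates x y hxy := by
    obtain ⟨f, hf, h⟩ := hG.separates x y (Subtype.coe_injective.ne hxy)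
    exact ⟨_, ⟨f, hf, rfl⟩, h⟩
  exists_common S hSG hne hdir hpos := by
    obtain ⟨x, hx⟩ := hG.exists_common
      {f | f ∈ G ∧ 0 ≤ f ∧ restr {x | ∀ h ∈ H, h x = 0} f ∈ S}
      (fun f hf => hf.1)
      (by
        obtain ⟨s, hs⟩ := hne
        obtain ⟨f, hf, rfl⟩ := hSG hs
        refine ⟨f ⊔ 0, hG.posPart_mem hf, le_sup_right, ?_⟩
        have : restr {x | ∀ h ∈ H, h x = 0} (f ⊔ 0) = restr _ f ⊔ 0 := rfl
        rwa [this, sup_eq_left.2 (hpos _ hs).1])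
      (by
        rintro f ⟨hf, hf0, hfS⟩ g ⟨hg, hg0, hgS⟩
        obtain ⟨k, hk, hkf, hkg⟩ := hdir _ hfS _ hgS
        obtain ⟨l, hl, rfl⟩ := hSG hk
        refine ⟨f ⊓ g ⊓ (l ⊔ 0), ⟨hG.inf_mem _ (hG.inf_mem f hf g hg) _ (hG.posPart_mem hl),
          le_inf (le_inf hf0 hg0) le_sup_right, ?_⟩, inf_le_left.trans inf_le_left,
          inf_le_left.trans inf_le_right⟩
        have : restr {x | ∀ h ∈ H, h x = 0} (f ⊓ g ⊓ (l ⊔ 0)) =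
          restr _ f ⊓ restr _ g ⊓ (restr _ l ⊔ 0) := rfl
        rwa [this, sup_eq_left.2 (hpos _ hk).1, inf_eq_right.2 (le_inf hkf hkg)])
      (by
        rintro f ⟨hf, hf0, hfS⟩
        refine ⟨hf0, ?_⟩
        rintro rfl
        exact (hpos _ hfS).2 (map_zero _))
    have hxY : ∀ h ∈ H, h x = 0 := by
      intro h hh
      by_contra hne0
      obtain ⟨s, hs⟩ := hne
      obtain ⟨f, hf, rfl⟩ := hSG hs
      obtain ⟨w, hw, hw0, -, hw1, hw2⟩ := hG.exists_cutoff (hHG hh) (hG.posPart_mem hf)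
        le_sup_right
      refine hx w ⟨hw, hw0, ?_⟩ (hw1 x hne0)
      have : restr {x | ∀ h ∈ H, h x = 0} w = restr _ f ⊔ 0 := by
        ext y
        exact hw2 y (y.2 h hh)
      rwa [this, sup_eq_left.2 (hpos _ hs).1]
    refine ⟨⟨x, hxY⟩, fun s hs => ?_⟩
    obtain ⟨f, hf, rfl⟩ := hSG hs
    have hpos' : restr {x | ∀ h ∈ H, h x = 0} (f ⊔ 0) = restr _ f := sup_eq_left.2 (hpos _ hs).1
    have h := hx (f ⊔ 0) ⟨hG.posPart_mem hf, le_sup_right, hpos'.symm ▸ hs⟩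
    rwa [show (f ⊔ 0) x = f x from congr_fun hpos' ⟨x, hxY⟩] at h

/-- Near any point of the support of `g` at which `f` is at least `n ≥ 1` there is a nonzero
function below `g` on whose support `f` is at least `n`, bounded by `1` where `f ≤ n`. -/
lemma exists_le_of_le_apply (hG : IsCompactIntLattice G) {f g : X → ℤ} (hf : f ∈ G) (hg : g ∈ G)
    (hg0 : 0 ≤ g) {n : ℕ} {x : X} (hgx : g x ≠ 0) (hfx : n ≤ f x) :
    ∃ w ∈ G, 0 ≤ w ∧ w ≤ g ∧ w x ≠ 0 ∧ (∀ y, w y ≠ 0 → n ≤ f y) ∧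
      ∀ y, 0 < n → f y ≤ n → w y ≤ 1 := by
  obtain ⟨e, he, hex⟩ := hG.exists_eq_one x
  obtain ⟨w, hw, hw0, hwg, hw1, hw2⟩ := hG.exists_cutoff
    (hG.posPart_mem (G.sub_mem (G.smul_mem (n : ℤ) he) hf))
    (hG.inf_mem _ (hG.posPart_mem he) _ hg) (le_inf le_sup_right hg0)
  have key : ∀ y, w y ≠ 0 → 1 ≤ e y ∧ n * e y ≤ f y ∧ w y ≤ e y := by
    intro y hy
    have h1 := not_imp_comm.1 (hw1 y) hy
    have h2 := hwg y
    have h3 := hw0 y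
    simp only [Pi.inf_apply, Pi.sup_apply, Pi.sub_apply, Pi.smul_apply, smul_eq_mul,
      Pi.zero_apply] at h1 h2 h3
    omega
  refine ⟨w, hw, hw0, hwg.trans inf_le_right, ?_, ?_, ?_⟩
  · have h1 := hw2 x (by simpa [hex] using hfx)
    rw [h1]
    have h2 := hg0 x
    simp only [Pi.inf_apply, Pi.sup_apply, Pi.zero_apply, hex] at h2 ⊢
    omega
  · intro y hy
    obtain ⟨h1, h2, -⟩ := key y hy
    nlinarith
  · intro y hn hfy
    by_cases hy : w y = 0
    · omega
    obtain ⟨h1, h2, h3⟩ := key y hy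
    have hn' : (1 : ℤ) ≤ n := by exact_mod_cast hn
    nlinarith

/-- A nonzero group contains a nonzero function with values in `{0, 1}`. -/
lemma exists_singular (hG : IsCompactIntLattice G) (hne : G ≠ ⊥) :
    ∃ s ∈ G, s ≠ 0 ∧ ∀ x, s x = 0 ∨ s x = 1 := by
  obtain ⟨f', hf', hf'0⟩ := Submodule.exists_mem_ne_zero_of_ne_bot hne
  obtain ⟨f, hf, hf0, hfne⟩ : ∃ f ∈ G, 0 ≤ f ∧ f ≠ 0 :=
    ⟨|f'|, hG.abs_mem hf', abs_nonneg _, by simpa using hf'0⟩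
  by_contra! hcon
  -- `f` is unbounded on the support of every nonzero `g ≤ f`
  have hunb : ∀ g ∈ G, 0 ≤ g → g ≠ 0 → g ≤ f → ∀ n : ℕ, ∃ x, g x ≠ 0 ∧ n ≤ f x := by
    intro g hg hg0 hgne hgf n
    by_contra! hbd
    obtain ⟨x₀, hx₀⟩ := Function.ne_iff.1 hgne
    obtain ⟨m, ⟨x, hgx, hfx⟩, hmax⟩ : ∃ m : ℕ, (∃ x, g x ≠ 0 ∧ f x = m) ∧
        ∀ y, g y ≠ 0 → f y ≤ m := by
      have hex : ∃ m : ℕ, ∀ y, g y ≠ 0 → f y ≤ m := ⟨n, fun y hy => (hbd y hy).le⟩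
      refine ⟨Nat.find hex, ?_, Nat.find_spec hex⟩
      by_contra! hno
      have hm := Nat.find_spec hex
      have hpos : 0 < Nat.find hex := by
        have h1 := hm x₀ hx₀
        have h2 := hno x₀ hx₀
        have h3 := hf0 x₀
        simp only [Pi.zero_apply] at h3
        omega
      refine Nat.find_min hex (Nat.sub_lt hpos one_pos) fun y hy => ?_
      have h1 := hm y hy
      have h2 := hno y hy
      omega
    obtain ⟨w, hw, hw0, hwg, hwx, -, hw1⟩ := hG.exists_le_of_le_apply hf hg hg0 hgx hfx.ge
    have hm : 0 < m := by
      have h1 := hgf x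
      have h2 := hg0 x
      simp only [Pi.zero_apply] at h2
      have h3 : 0 < f x := (lt_of_le_of_ne h2 hgx.symm).trans_le h1
      omega
    obtain ⟨y, hy0, hy1⟩ := hcon w hw (fun h => hwx (congr_fun h x))
    have hgy : g y ≠ 0 := by
      have h1 := hwg y
      have h2 := hw0 y
      simp only [Pi.zero_apply] at h2
      exact (lt_of_lt_of_le (lt_of_le_of_ne h2 hy0.symm) h1).ne'
    have h1 := hw1 y hm (hmax y hgy)
    have h2 := hw0 y
    simp only [Pi.zero_apply] at h2
    omega
  have hstep : ∀ (n : ℕ) (g : {g : X → ℤ // g ∈ G ∧ 0 ≤ g ∧ g ≠ 0 ∧ g ≤ f}),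
      ∃ w : {g : X → ℤ // g ∈ G ∧ 0 ≤ g ∧ g ≠ 0 ∧ g ≤ f}, w.1 ≤ g.1 ∧
        ∀ y, w.1 y ≠ 0 → n ≤ f y := by
    rintro n ⟨g, hg, hg0, hgne, hgf⟩
    obtain ⟨x, hgx, hfx⟩ := hunb g hg hg0 hgne hgf n
    obtain ⟨w, hw, hw0, hwg, hwx, hw1, -⟩ := hG.exists_le_of_le_apply hf hg hg0 hgx hfx
    exact ⟨⟨w, hw, hw0, fun h => hwx (congr_fun h x), hwg.trans hgf⟩, hwg, hw1⟩
  choose next hnext hlarge using hstep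
  let seq : ℕ → {g : X → ℤ // g ∈ G ∧ 0 ≤ g ∧ g ≠ 0 ∧ g ≤ f} :=
    fun n => Nat.rec ⟨f, hf, hf0, hfne, le_rfl⟩ next n
  have hanti : Antitone fun n => (seq n).1 := antitone_nat_of_succ_le fun n => hnext n (seq n)
  obtain ⟨x, hx⟩ := hG.exists_common (Set.range fun n => (seq n).1)
    (by rintro _ ⟨n, rfl⟩; exact (seq n).2.1) (Set.range_nonempty _)
    (by
      rintro _ ⟨m, rfl⟩ _ ⟨n, rfl⟩
      exact ⟨_, ⟨max m n, rfl⟩, hanti (le_max_left _ _), hanti (le_max_right _ _)⟩)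
    (by rintro _ ⟨n, rfl⟩; exact ⟨(seq n).2.2.1, (seq n).2.2.2.1⟩)
  have h1 := hlarge ((f x).toNat + 1) (seq ((f x).toNat + 1)) x
    (hx _ ⟨(f x).toNat + 1 + 1, rfl⟩)
  push_cast at h1
  have h2 := Int.self_le_toNat (f x)
  omega

/-- The elements of `G` vanishing outside the support of `s`. -/
def supportedOn (G : Submodule ℤ (X → ℤ)) (s : X → ℤ) : Submodule ℤ (X → ℤ) where
  carrier := {g | g ∈ G ∧ ∀ x, s x = 0 → g x = 0}
  zero_mem' := ⟨G.zero_mem, fun _ _ => rfl⟩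
  add_mem' := fun hf hg => ⟨G.add_mem hf.1 hg.1, fun x hx => by simp [hf.2 x hx, hg.2 x hx]⟩
  smul_mem' := fun n f hf => ⟨G.smul_mem n hf.1, fun x hx => by simp [hf.2 x hx]⟩

/-- The topology on the support of `s` generated by the supports of the functions in `G`. -/
abbrev supportTopology (G : Submodule ℤ (X → ℤ)) (s : X → ℤ) :
    TopologicalSpace {x // s x ≠ 0} :=
  TopologicalSpace.generateFrom {U | ∃ f ∈ G, U = {x : {x // s x ≠ 0} | f x ≠ 0}}

lemma isTopologicalBasis_support (hG : IsCompactIntLattice G) {s : X → ℤ} (hs : s ∈ G) :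
    @TopologicalSpace.IsTopologicalBasis _ (supportTopology G s)
      {U | ∃ f ∈ G, U = {x : {x // s x ≠ 0} | f x ≠ 0}} := by
  let _ := supportTopology G s
  refine ⟨?_, ?_, rfl⟩
  · rintro _ ⟨f, hf, rfl⟩ _ ⟨g, hg, rfl⟩ x ⟨hxf, hxg⟩
    refine ⟨_, ⟨|f| ⊓ |g|, hG.inf_mem _ (hG.abs_mem hf) _ (hG.abs_mem hg), rfl⟩, ?_, ?_⟩
    · have h1 := abs_pos.2 hxf
      have h2 := abs_pos.2 hxg
      simp only [Set.mem_ofPred_eq, Pi.inf_apply, Pi.abs_apply]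
      omega
    · intro y hy
      simp only [Set.mem_ofPred_eq, Pi.inf_apply, Pi.abs_apply, Set.mem_inter_iff] at hy ⊢
      constructor <;> intro h <;> simp [h] at hy
  · exact Set.eq_univ_of_forall fun x => ⟨_, ⟨s, hs, rfl⟩, x.2⟩

lemma isClopen_support (hG : IsCompactIntLattice G) {s : X → ℤ} (hs : s ∈ G) {f : X → ℤ}
    (hf : f ∈ G) : @IsClopen _ (supportTopology G s) {x : {x // s x ≠ 0} | f x ≠ 0} := by
  let _ := supportTopology G s
  refine ⟨⟨?_⟩, TopologicalSpace.isOpen_generateFrom_of_mem ⟨f, hf, rfl⟩⟩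
  obtain ⟨w, hw, -, -, hw1, hw2⟩ := hG.exists_cutoff hf (hG.abs_mem hs) (abs_nonneg s)
  refine TopologicalSpace.isOpen_generateFrom_of_mem ⟨w, hw, ?_⟩
  ext x
  simp only [Set.mem_compl_iff, Set.mem_ofPred_eq, not_not]
  refine ⟨fun h => ?_, fun h => by_contra fun h' => h (hw1 x h')⟩
  rw [hw2 x h]
  simpa using x.2

lemma compactSpace_support (hG : IsCompactIntLattice G) {s : X → ℤ} (hs : s ∈ G) :
    @CompactSpace _ (supportTopology G s) := by
  let _ := supportTopology G s
  refine ⟨isCompact_iff_ultrafilter_le_nhds.2 fun 𝓤 _ => ?_⟩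
  have hsU : {x : {x // s x ≠ 0} | |s| x ≠ 0} ∈ 𝓤 :=
    Filter.mem_of_superset Filter.univ_mem fun x _ => by simpa using x.2
  obtain ⟨x, hx⟩ := hG.exists_common
    {f | f ∈ G ∧ 0 ≤ f ∧ {x : {x // s x ≠ 0} | f x ≠ 0} ∈ 𝓤} (fun f hf => hf.1)
    ⟨|s|, hG.abs_mem hs, abs_nonneg s, hsU⟩
    (by
      rintro f ⟨hf, hf0, hfU⟩ g ⟨hg, hg0, hgU⟩
      refine ⟨f ⊓ g, ⟨hG.inf_mem f hf g hg, le_inf hf0 hg0, ?_⟩, inf_le_left, inf_le_right⟩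
      filter_upwards [hfU, hgU] with x h1 h2
      have h3 := hf0 x
      have h4 := hg0 x
      simp only [Pi.inf_apply, Pi.zero_apply] at *
      omega)
    (by
      rintro f ⟨hf, hf0, hfU⟩
      refine ⟨hf0, ?_⟩
      rintro rfl
      simp at hfU)
  have hcut : ∀ f ∈ G, f x ≠ 0 → {x : {x // s x ≠ 0} | f x ≠ 0} ∈ 𝓤 := by
    intro f hf hfx
    by_contra hnot
    obtain ⟨w, hw, hw0, -, hw1, hw2⟩ := hG.exists_cutoff hf (hG.abs_mem hs) (abs_nonneg s)
    refine hx w ⟨hw, hw0, ?_⟩ (hw1 x hfx)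
    filter_upwards [Ultrafilter.compl_mem_iff_notMem.2 hnot] with y hy
    simp only [Set.mem_compl_iff, Set.mem_ofPred_eq, not_not] at hy ⊢
    rw [hw2 y hy]
    simpa using y.2
  have hsx : s x ≠ 0 := by
    simpa using hx |s| ⟨hG.abs_mem hs, abs_nonneg s, hsU⟩
  refine ⟨⟨x, hsx⟩, Set.mem_univ _, ?_⟩
  rw [TopologicalSpace.nhds_generateFrom]
  simp only [le_iInf_iff, Filter.le_principal_iff, Set.mem_ofPred_eq]
  rintro _ ⟨hxU, f, hf, rfl⟩
  exact hcut f hf hxU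

lemma exists_isClopen_separating (hG : IsCompactIntLattice G) {s : X → ℤ} (hs : s ∈ G) :
    ∀ x y : {x // s x ≠ 0}, x ≠ y →
      ∃ U : Set {x // s x ≠ 0}, @IsClopen _ (supportTopology G s) U ∧ x ∈ U ∧ y ∈ Uᶜ := by
  let _ := supportTopology G s
  intro x y hxy
  obtain ⟨f, hf, hfx, hfy⟩ := hG.separates x y (Subtype.coe_injective.ne hxy)
  exact ⟨_, hG.isClopen_support hs hf, hfx, by simpa using hfy⟩

/-- The indicator function of a compact open subset of the support belongs to `G`. -/
lemma indicator_mem (hG : IsCompactIntLattice G) {s : X → ℤ} (hs : s ∈ G)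
    (hs01 : ∀ x, s x = 0 ∨ s x = 1) {U : Set {x // s x ≠ 0}}
    (hU : @IsClopen _ (supportTopology G s) U) :
    (((↑) '' U : Set X).indicator 1 : X → ℤ) ∈ G := by
  let _ := supportTopology G s
  have := hG.compactSpace_support hs
  have hs0 : 0 ≤ s := fun x => by rcases hs01 x with h | h <;> simp [h]
  obtain ⟨g, hg, hg0, hgs, hg1, hgU⟩ : ∃ g ∈ G, 0 ≤ g ∧ g ≤ s ∧ (∀ x ∈ U, g x ≠ 0) ∧
      ∀ x ∉ U, g x = 0 := by
    refine hU.isClosed.isCompact.induction_on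
      (p := fun T => ∃ g ∈ G, 0 ≤ g ∧ g ≤ s ∧ (∀ x ∈ T, g x ≠ 0) ∧ ∀ x ∉ U, g x = 0)
      ⟨0, G.zero_mem, le_rfl, hs0, by simp, by simp⟩ ?_ ?_ ?_
    · rintro T T' hT ⟨g, hg, hg0, hgs, h1, h2⟩
      exact ⟨g, hg, hg0, hgs, fun x hx => h1 x (hT hx), h2⟩
    · rintro T T' ⟨g, hg, hg0, hgs, h1, h2⟩ ⟨g', hg', hg'0, hgs', h1', h2'⟩
      refine ⟨g ⊔ g', hG.sup_mem hg hg', hg0.trans le_sup_left, sup_le hgs hgs', ?_, ?_⟩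
      · intro x hx
        have h3 := hg0 x
        have h4 := hg'0 x
        simp only [Pi.sup_apply, Pi.zero_apply] at *
        rcases hx with hx | hx
        · have := h1 x hx
          omega
        · have := h1' x hx
          omega
      · intro x hx
        simp [h2 x hx, h2' x hx]
    · intro x hx
      obtain ⟨_, ⟨f, hf, rfl⟩, hxf, hfU⟩ :=
        (hG.isTopologicalBasis_support hs).exists_subset_of_mem_open hx hU.isOpen
      refine ⟨_, mem_nhdsWithin_of_mem_nhds ((hG.isClopen_support hs hf).isOpen.mem_nhds hxf),
        |f| ⊓ s, hG.inf_mem _ (hG.abs_mem hf) _ hs, le_inf (abs_nonneg f) hs0, inf_le_right,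
        ?_, ?_⟩
      · intro y hy
        have h1 := abs_pos.2 hy
        have h2 := y.2
        have h3 := hs0 y
        simp only [Pi.inf_apply, Pi.abs_apply, Pi.zero_apply] at *
        omega
      · intro y hy
        have hfy : f y = 0 := by_contra fun h => hy (hfU h)
        have h3 := hs0 y
        simp only [Pi.inf_apply, Pi.abs_apply, Pi.zero_apply, hfy, abs_zero] at *
        omega
  convert hg using 1
  ext x
  have h3 := hg0 x
  have h4 := hgs x
  rw [Pi.zero_apply] at h3
  by_cases hx : s x = 0
  · rw [Set.indicator_of_notMem]
    · exact le_antisymm h3 (h4.trans hx.le)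
    · rintro ⟨y, -, rfl⟩
      exact y.2 hx
  · have h5 := (hs01 x).resolve_left hx
    by_cases hxU : (⟨x, hx⟩ : {x // s x ≠ 0}) ∈ U
    · have h6 := hg1 _ hxU
      rw [Set.indicator_of_mem (Set.mem_image_of_mem Subtype.val hxU)]
      simp only [Pi.one_apply] at *
      omega
    · rw [Set.indicator_of_notMem, hgU _ hxU]
      rintro ⟨y, hy, rfl⟩
      exact hxU hy

/-- Nöbeling's theorem for the functions supported on a `{0, 1}`-valued function. -/
lemma free_supportedOn (hG : IsCompactIntLattice G) {s : X → ℤ} (hs : s ∈ G)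
    (hs01 : ∀ x, s x = 0 ∨ s x = 1) : Module.Free ℤ (supportedOn G s) := by
  let _ := supportTopology G s
  have := hG.compactSpace_support hs
  have : TotallySeparatedSpace {x // s x ≠ 0} :=
    totallySeparatedSpace_iff_exists_isClopen.2 (hG.exists_isClopen_separating hs)
  let φ : LocallyConstant {x // s x ≠ 0} ℤ →ₗ[ℤ] (X → ℤ) :=
    (Function.ExtendByZero.linearMap ℤ ((↑) : {x // s x ≠ 0} → X)).comp
      (LocallyConstant.coeFnₗ ℤ)
  have hφ : ∀ c x, φ c x = if h : s x ≠ 0 then c ⟨x, h⟩ else 0 := by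
    intro c x
    split_ifs with h
    · exact Subtype.coe_injective.extend_apply c 0 ⟨x, h⟩
    · exact Function.extend_apply' _ _ _ fun ⟨y, hy⟩ => h (hy ▸ y.2)
  have hinj : Function.Injective φ := by
    intro c d hcd
    ext x
    have := congr_fun hcd x
    simpa [hφ, x.2] using this
  have hrange : LinearMap.range φ = supportedOn G s := by
    apply le_antisymm
    · rintro _ ⟨c, rfl⟩
      refine ⟨?_, fun x hx => by simp [hφ, hx]⟩
      have hsum : φ c = ∑ n ∈ c.range_finite.toFinset,
          n • (((↑) '' (c ⁻¹' {n}) : Set X).indicator 1 : X → ℤ) := by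
        ext x
        rw [hφ, Finset.sum_apply]
        split_ifs with h
        · rw [Finset.sum_eq_single (c ⟨x, h⟩)]
          · rw [Pi.smul_apply, Set.indicator_of_mem (Set.mem_image_of_mem Subtype.val
              (show (⟨x, h⟩ : {x // s x ≠ 0}) ∈ c ⁻¹' {c ⟨x, h⟩} from rfl))]
            simp
          · intro n _ hn
            rw [Pi.smul_apply, Set.indicator_of_notMem, smul_zero]
            rintro ⟨y, hy, rfl⟩
            exact hn hy.symm
          · simp
        · refine (Finset.sum_eq_zero fun n _ => ?_).symm
          rw [Pi.smul_apply, Set.indicator_of_notMem, smul_zero]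
          rintro ⟨y, -, rfl⟩
          exact h y.2
      rw [hsum]
      exact G.sum_mem fun n _ => G.smul_mem _
        (hG.indicator_mem hs hs01 (c.isLocallyConstant.isClopen_fiber n))
    · rintro g ⟨hg, hgs⟩
      refine ⟨⟨fun x => g x, (IsLocallyConstant.iff_isOpen_fiber).2 fun n => ?_⟩, ?_⟩
      · have := (hG.isClopen_support hs (G.sub_mem hg (G.smul_mem n hs))).compl.isOpen
        convert this using 1
        ext x
        have := (hs01 x).resolve_left x.2
        simp [this, sub_eq_zero]
      · ext x
        rw [hφ]
        split_ifs with h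
        · rfl
        · exact (hgs x (not_not.1 h)).symm
  rw [← hrange]
  have : Module.Free ℤ (LocallyConstant {x // s x ≠ 0} ℤ) :=
    LocallyConstant.freeOfProfinite (Profinite.of {x // s x ≠ 0})
  exact Module.Free.of_equiv (LinearEquiv.ofInjective φ hinj)

/-- A basis of a solid proper subgroup extends to a basis of a strictly larger one. -/
lemma exists_extension (hG : IsCompactIntLattice G) {B : Set (X → ℤ)}
    (hB : LinearIndepOn ℤ id B) (hBG : Submodule.span ℤ B ≤ G)
    (hsolid : ∀ g ∈ G, ∀ h ∈ Submodule.span ℤ B, |g| ≤ |h| → g ∈ Submodule.span ℤ B)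
    (hne : Submodule.span ℤ B ≠ G) :
    ∃ B', B ⊆ B' ∧ B' ≠ B ∧ LinearIndepOn ℤ id B' ∧ Submodule.span ℤ B' ≤ G ∧
      ∀ g ∈ G, ∀ h ∈ Submodule.span ℤ B', |g| ≤ |h| → g ∈ Submodule.span ℤ B' := by
  set H := Submodule.span ℤ B with hH
  set Y : Set X := {x | ∀ h ∈ H, h x = 0} with hY
  set ρ := restr Y with hρ
  have hGY := hG.map_restr hBG
  have hker : ∀ g ∈ G, ρ g = 0 → g ∈ H := fun g hg h0 =>
    hG.mem_of_forall_eq_zero hBG hsolid hg fun x hx => congr_fun h0 ⟨x, hx⟩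
  have hHker : H ≤ LinearMap.ker ρ := fun h hh => by
    ext y
    exact y.2 h hh
  have hneY : G.map ρ ≠ ⊥ := by
    intro h0
    refine hne (le_antisymm hBG fun g hg => hker g hg ?_)
    have : ρ g ∈ G.map ρ := ⟨g, hg, rfl⟩
    rwa [h0, Submodule.mem_bot] at this
  obtain ⟨s, hs, hs0, hs01⟩ := hGY.exists_singular hneY
  have := hGY.free_supportedOn hs hs01
  let b := Module.Free.chooseBasis ℤ (supportedOn (G.map ρ) s)
  have hlift : ∀ i, ∃ g ∈ G, ρ g = b i := fun i => (b i).2.1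
  choose c hcG hc using hlift
  have hbind : LinearIndependent ℤ (ρ ∘ c) := by
    have h1 : ρ ∘ c = (supportedOn (G.map ρ) s).subtype ∘ b := funext hc
    rw [h1]
    exact b.linearIndependent.map' _ (Submodule.ker_subtype _)
  have hspan : (Submodule.span ℤ (Set.range c)).map ρ = supportedOn (G.map ρ) s := by
    have h1 : ρ ∘ c = (supportedOn (G.map ρ) s).subtype ∘ b := funext hc
    rw [Submodule.map_span, ← Set.range_comp, h1, Set.range_comp, ← Submodule.map_span,
      b.span_eq, Submodule.map_top, Submodule.range_subtype]
  have hcG' : Submodule.span ℤ (Set.range c) ≤ G :=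
    Submodule.span_le.2 (Set.range_subset_iff.2 hcG)
  have hmem : ∀ g, g ∈ Submodule.span ℤ (B ∪ Set.range c) ↔
      g ∈ G ∧ ρ g ∈ supportedOn (G.map ρ) s := by
    intro g
    rw [Submodule.span_union, ← hH]
    constructor
    · intro hg
      refine ⟨sup_le hBG hcG' hg, ?_⟩
      obtain ⟨h, hh, k, hk, rfl⟩ := Submodule.mem_sup.1 hg
      rw [map_add, LinearMap.mem_ker.1 (hHker hh), zero_add, ← hspan]
      exact ⟨k, hk, rfl⟩
    · rintro ⟨hg, hgs⟩
      rw [← hspan] at hgs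
      obtain ⟨k, hk, hkg⟩ := hgs
      rw [← sub_add_cancel g k]
      exact Submodule.add_mem_sup
        (hker _ (G.sub_mem hg (hcG' hk)) (by rw [map_sub, hkg, sub_self])) hk
  refine ⟨B ∪ Set.range c, Set.subset_union_left, ?_, ?_, fun g hg => ((hmem g).1 hg).1, ?_⟩
  · intro heq
    have h1 : s ∈ supportedOn (G.map ρ) s := ⟨hs, fun _ h => h⟩
    rw [← hspan] at h1
    obtain ⟨k, hk, rfl⟩ := h1
    have h2 : Submodule.span ℤ (Set.range c) ≤ H :=
      Submodule.span_mono (Set.union_eq_left.1 heq)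
    exact hs0 (hHker (h2 hk))
  · refine LinearIndepOn.id_union hB (LinearIndependent.linearIndepOn_id (.of_comp ρ hbind)) ?_
    exact ((Submodule.range_ker_disjoint hbind).mono_right hHker).symm
  · intro g hg h hh hgh
    rw [hmem] at hh ⊢
    refine ⟨hg, ⟨g, hg, rfl⟩, fun y hy => ?_⟩
    have h1 : h y = 0 := hh.2.2 y hy
    have h2 := hgh y
    simp only [Pi.abs_apply, h1, abs_zero, abs_nonpos_iff] at h2
    exact h2

theorem free (hG : IsCompactIntLattice G) : Module.Free ℤ G := by
  obtain ⟨B, hB⟩ := zorn_subset {B : Set (X → ℤ) | LinearIndepOn ℤ id B ∧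
      Submodule.span ℤ B ≤ G ∧
      ∀ g ∈ G, ∀ h ∈ Submodule.span ℤ B, |g| ≤ |h| → g ∈ Submodule.span ℤ B} (by
    intro C hC hchain
    by_cases hCne : C.Nonempty
    · refine ⟨⋃₀ C, ⟨?_, ?_, ?_⟩, fun B hB => Set.subset_sUnion_of_mem hB⟩
      · exact linearIndepOn_sUnion_of_directed hchain.directedOn fun B hB => (hC hB).1
      · rw [Submodule.span_le]
        exact Set.sUnion_subset fun B hB => Submodule.span_le.1 (hC hB).2.1
      · intro g hg h hh hgh
        have := hCne.to_subtype
        have hdir : Directed (· ≤ ·) fun B : C => Submodule.span ℤ (B : Set (X → ℤ)) := by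
          intro B₁ B₂
          obtain ⟨B₃, hB₃, h₁, h₂⟩ := hchain.directedOn _ B₁.2 _ B₂.2
          exact ⟨⟨B₃, hB₃⟩, Submodule.span_mono h₁, Submodule.span_mono h₂⟩
        rw [Set.sUnion_eq_iUnion, Submodule.span_iUnion, Submodule.mem_iSup_of_directed _ hdir]
          at hh ⊢
        obtain ⟨B, hB⟩ := hh
        exact ⟨B, (hC B.2).2.2 g hg h hB hgh⟩
    · refine ⟨∅, ⟨linearIndepOn_empty _ _, by simp, ?_⟩, fun B hB => (hCne ⟨B, hB⟩).elim⟩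
      intro g hg h hh hgh
      rw [Submodule.span_empty, Submodule.mem_bot] at hh ⊢
      rw [hh, abs_zero] at hgh
      ext x
      have := hgh x
      simpa using this)
  obtain ⟨hlin, hle, hsolid⟩ := hB.prop
  have hspan : Submodule.span ℤ B = G := by
    by_contra hne
    obtain ⟨B', hBB', hneB, hB'⟩ := hG.exists_extension hlin hle hsolid hne
    exact hneB (hB.eq_of_subset hB' hBB').symm
  have hb := Module.Free.of_basis (Module.Basis.span hlin)
  have hrange : Set.range (fun x : B => id (x : X → ℤ)) = B := Subtype.range_coe
  rwa [hrange, hspan] at hb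

end IsCompactIntLattice

section FractionalIdeal

open nonZeroDivisors IsDedekindDomain FractionalIdeal

/-- In a discrete valuation ring, the order of a fractional ideal detects containment of `1`. -/
lemma count_nonpos_iff_one_le {A L : Type*} [CommRing A] [IsDomain A] [IsDiscreteValuationRing A]
    [Field L] [Algebra A L] [IsFractionRing A L] {I : FractionalIdeal A⁰ L} (hI : I ≠ 0) :
    count L (IsDiscreteValuationRing.maximalIdeal A) I ≤ 0 ↔ 1 ≤ I := by
  set v := IsDiscreteValuationRing.maximalIdeal A
  refine ⟨fun h => ?_, fun h => (count_mono L v one_ne_zero h).trans_eq (count_one L v)⟩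
  have huniq : ∀ w : HeightOneSpectrum A, w = v := fun w =>
    HeightOneSpectrum.ext (IsLocalRing.eq_maximalIdeal w.isMaximal)
  have hfac := finprod_heightOneSpectrum_factorization' L hI
  rw [finprod_eq_single _ v fun w hw => (hw (huniq w)).elim] at hfac
  obtain ⟨n, hn⟩ := Int.eq_ofNat_of_zero_le (neg_nonneg.2 h)
  have hle : I⁻¹ ≤ 1 := by
    rw [← hfac, ← zpow_neg, hn, zpow_natCast, ← coeIdeal_pow]
    exact coeIdeal_le_one
  calc (1 : FractionalIdeal A⁰ L) = I * I⁻¹ := (mul_inv_cancel₀ hI).symm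
    _ ≤ I * 1 := mul_le_mul_right hle I
    _ = I := mul_one I

variable {R K : Type*} [CommRing R] [Field K] [Algebra R K]

/-- A fractional ideal containing, for every maximal ideal `M`, an element of `R` outside `M`
contains `1`. -/
lemma one_le_of_forall_exists_notMem {I : FractionalIdeal R⁰ K}
    (h : ∀ M : MaximalSpectrum R, ∃ s ∉ M.asIdeal, algebraMap R K s ∈ I) : 1 ≤ I := by
  by_contra hI
  have hne : Submodule.comap (Algebra.linearMap R K) I.coeToSubmodule ≠ ⊤ := fun htop => by
    have h1 : (1 : R) ∈ Submodule.comap (Algebra.linearMap R K) I.coeToSubmodule :=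
      htop ▸ Submodule.mem_top
    rw [Submodule.mem_comap, Algebra.linearMap_apply, map_one] at h1
    exact hI (FractionalIdeal.one_le.2 h1)
  obtain ⟨M, hM, hle⟩ := Ideal.exists_le_maximal _ hne
  obtain ⟨s, hs, hsI⟩ := h ⟨M, hM⟩
  exact hs (hle hsI)

variable [IsFractionRing R K]

lemma mem_add_mul_inf_inv (I J : (FractionalIdeal R⁰ K)ˣ) {s : R}
    (hs : algebraMap R K s ∈ ((I * J⁻¹ : (FractionalIdeal R⁰ K)ˣ) : FractionalIdeal R⁰ K)) :
    algebraMap R K s ∈ ((I + J) * (↑I⁻¹ ⊓ ↑J⁻¹) : FractionalIdeal R⁰ K) := by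
  have h1 : spanSingleton R⁰ (algebraMap R K s) * ↑I⁻¹ ≤ (↑I⁻¹ ⊓ ↑J⁻¹ : FractionalIdeal R⁰ K) := by
    refine le_inf ?_ ?_
    · calc spanSingleton R⁰ (algebraMap R K s) * ↑I⁻¹ ≤ 1 * (↑I⁻¹ : FractionalIdeal R⁰ K) :=
            mul_le_mul_left (spanSingleton_le_iff_mem.2 (coe_mem_one _ s)) _
        _ = ↑I⁻¹ := one_mul _
    · calc spanSingleton R⁰ (algebraMap R K s) * ↑I⁻¹
          ≤ ((I * J⁻¹ : (FractionalIdeal R⁰ K)ˣ) : FractionalIdeal R⁰ K) * ↑I⁻¹ :=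
            mul_le_mul_left (spanSingleton_le_iff_mem.2 hs) _
        _ = ↑J⁻¹ := by rw [← Units.val_mul, mul_comm I, mul_inv_cancel_right]
  rw [← spanSingleton_le_iff_mem]
  calc spanSingleton R⁰ (algebraMap R K s)
      = I * (spanSingleton R⁰ (algebraMap R K s) * ↑I⁻¹) := by
        rw [mul_left_comm, Units.mul_inv, mul_one]
    _ ≤ I * (↑I⁻¹ ⊓ ↑J⁻¹) := mul_le_mul_right h1 _
    _ ≤ (I + J) * (↑I⁻¹ ⊓ ↑J⁻¹) := mul_le_mul_left (by rw [← sup_eq_add]; exact le_sup_left) _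

lemma mem_mul_inv_of_eq_sup {I J S : (FractionalIdeal R⁰ K)ˣ}
    (hS : (S : FractionalIdeal R⁰ K) = ↑I ⊔ ↑J) {s : R}
    (hs : algebraMap R K s ∈ ((I * J⁻¹ : (FractionalIdeal R⁰ K)ˣ) : FractionalIdeal R⁰ K)) :
    algebraMap R K s ∈ ((I * S⁻¹ : (FractionalIdeal R⁰ K)ˣ) : FractionalIdeal R⁰ K) := by
  have h1 : spanSingleton R⁰ (algebraMap R K s) * S ≤ (I : FractionalIdeal R⁰ K) := by
    rw [hS, sup_eq_add, mul_add, ← sup_eq_add]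
    refine sup_le ?_ ?_
    · calc spanSingleton R⁰ (algebraMap R K s) * I ≤ 1 * (I : FractionalIdeal R⁰ K) :=
            mul_le_mul_left (spanSingleton_le_iff_mem.2 (coe_mem_one _ s)) _
        _ = I := one_mul _
    · calc spanSingleton R⁰ (algebraMap R K s) * J
          ≤ ((I * J⁻¹ : (FractionalIdeal R⁰ K)ˣ) : FractionalIdeal R⁰ K) * J :=
            mul_le_mul_left (spanSingleton_le_iff_mem.2 hs) _
        _ = I := by rw [← Units.val_mul, inv_mul_cancel_right]
  rw [← spanSingleton_le_iff_mem]
  calc spanSingleton R⁰ (algebraMap R K s)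
      = spanSingleton R⁰ (algebraMap R K s) * S * ↑S⁻¹ := by
        rw [mul_assoc, Units.mul_inv, mul_one]
    _ ≤ I * ↑S⁻¹ := mul_le_mul_left h1 _
    _ = _ := (Units.val_mul _ _).symm

/-- The sum of two invertible fractional ideals that are locally comparable is invertible. -/
lemma isUnit_add_of_locally_comparable (I J : (FractionalIdeal R⁰ K)ˣ)
    (h : ∀ M : MaximalSpectrum R, ∃ s ∉ M.asIdeal,
      algebraMap R K s ∈ ((I * J⁻¹ : (FractionalIdeal R⁰ K)ˣ) : FractionalIdeal R⁰ K) ∨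
      algebraMap R K s ∈ ((J * I⁻¹ : (FractionalIdeal R⁰ K)ˣ) : FractionalIdeal R⁰ K)) :
    IsUnit (I + J : FractionalIdeal R⁰ K) := by
  refine IsUnit.of_mul_eq_one (↑I⁻¹ ⊓ ↑J⁻¹) (le_antisymm ?_ ?_)
  · rw [add_mul, ← sup_eq_add]
    refine sup_le ?_ ?_
    · exact (mul_le_mul_right inf_le_left _).trans_eq (Units.mul_inv I)
    · exact (mul_le_mul_right inf_le_right _).trans_eq (Units.mul_inv J)
  · refine one_le_of_forall_exists_notMem fun M => ?_
    obtain ⟨s, hs, hI | hJ⟩ := h M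
    · exact ⟨s, hs, mem_add_mul_inf_inv I J hI⟩
    · refine ⟨s, hs, ?_⟩
      rw [add_comm, inf_comm]
      exact mem_add_mul_inf_inv J I hJ

variable [IsDomain R]

/-- The extension of a fractional ideal to the localization at `M` contains `1` if and only if
the fractional ideal contains an element of `R` outside `M`. -/
lemma one_le_extendedHom_localization_iff (M : MaximalSpectrum R) (A L : Type*) [CommRing A]
    [IsDomain A] [Algebra R A] [Module.IsTorsionFree R A] [IsLocalization.AtPrime A M.asIdeal]
    [Field L] [Algebra A L] [IsFractionRing A L] (I : FractionalIdeal R⁰ K) :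
    1 ≤ extendedHom L A I ↔ ∃ s ∉ M.asIdeal, algebraMap R K s ∈ I := by
  rw [FractionalIdeal.one_le, extendedHom'_apply, mem_extended_iff]
  have hf : R⁰ ≤ Submonoid.comap (algebraMap R A) A⁰ :=
    nonZeroDivisors_le_comap_nonZeroDivisors_of_injective _
      (FaithfulSMul.algebraMap_injective R A)
  set φ : K →+* L := IsLocalization.map L (algebraMap R A) hf
  have hφ : ∀ r, φ (algebraMap R K r) = algebraMap A L (algebraMap R A r) :=
    IsLocalization.map_eq hf
  constructor
  · intro h
    have key : ∀ y ∈ Submodule.span A (φ '' I), ∃ s ∉ M.asIdeal, ∃ c ∈ I,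
        φ c = φ (algebraMap R K s) * y := by
      intro y hy
      induction hy using Submodule.span_induction with
      | mem y hy =>
        obtain ⟨c, hc, rfl⟩ := hy
        exact ⟨1, M.asIdeal.one_notMem, c, hc, by simp⟩
      | zero => exact ⟨1, M.asIdeal.one_notMem, 0, I.coeToSubmodule.zero_mem, by simp⟩
      | add y z _ _ hy hz =>
        obtain ⟨s, hs, c, hc, hcy⟩ := hy
        obtain ⟨t, ht, d, hd, hdz⟩ := hz
        refine ⟨s * t, M.isMaximal.isPrime.mul_notMem hs ht, t • c + s • d,
          I.coeToSubmodule.add_mem (I.coeToSubmodule.smul_mem t hc)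
            (I.coeToSubmodule.smul_mem s hd), ?_⟩
        simp only [Algebra.smul_def, map_add, map_mul, hcy, hdz]
        ring
      | smul a y _ hy =>
        obtain ⟨s, hs, c, hc, hcy⟩ := hy
        obtain ⟨r, t, rfl⟩ := IsLocalization.exists_mk'_eq M.asIdeal.primeCompl a
        refine ⟨s * t, M.isMaximal.isPrime.mul_notMem hs t.2, r • c,
          I.coeToSubmodule.smul_mem r hc, ?_⟩
        simp only [Algebra.smul_def, map_mul, hcy, hφ, ← IsLocalization.mk'_spec A r t]
        ring
    obtain ⟨s, hs, c, hc, hcs⟩ := key 1 h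
    rw [mul_one] at hcs
    exact ⟨s, hs, φ.injective hcs ▸ hc⟩
  · rintro ⟨s, hs, hsI⟩
    obtain ⟨u, hu⟩ := (IsLocalization.AtPrime.isUnit_to_map_iff A M.asIdeal s).2 hs
    have h1 : (1 : L) = (↑u⁻¹ : A) • φ (algebraMap R K s) := by
      rw [hφ, ← hu, Algebra.smul_def, ← map_mul, Units.inv_mul, map_one]
    rw [h1]
    exact Submodule.smul_mem _ _ (Submodule.subset_span ⟨_, hsI, rfl⟩)

/-- The order of an invertible fractional ideal at `M`. -/
lemma exists_localOrder (M : MaximalSpectrum R) (A : Type*) [CommRing A] [IsDomain A]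
    [Algebra R A] [Module.IsTorsionFree R A] [IsLocalization.AtPrime A M.asIdeal]
    [IsDiscreteValuationRing A] :
    ∃ v : Additive (FractionalIdeal R⁰ K)ˣ →+ ℤ,
      (∀ C : (FractionalIdeal R⁰ K)ˣ, v (.ofMul C) ≤ 0 ↔
        ∃ s ∉ M.asIdeal, algebraMap R K s ∈ (C : FractionalIdeal R⁰ K)) ∧
      ∃ C, v C = 1 := by
  let L := FractionRing A
  have hne : ∀ C : (FractionalIdeal R⁰ K)ˣ, extendedHom L A (C : FractionalIdeal R⁰ K) ≠ 0 :=
    fun C => (extendedHom_eq_zero_iff L A).not.2 C.ne_zero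
  refine ⟨
    { toFun := fun C => count L (IsDiscreteValuationRing.maximalIdeal A)
        (extendedHom L A (C.toMul : FractionalIdeal R⁰ K))
      map_zero' := by simp [count_one]
      map_add' := fun C D => by
        rw [toMul_add, Units.val_mul, map_mul, count_mul _ _ (hne _) (hne _)] }, ?_, ?_⟩
  · intro C
    exact (count_nonpos_iff_one_le (hne C)).trans (one_le_extendedHom_localization_iff M A L _)
  · obtain ⟨ϖ, hϖ⟩ := IsDiscreteValuationRing.exists_irreducible A
    obtain ⟨r, t, rfl⟩ := IsLocalization.exists_mk'_eq M.asIdeal.primeCompl ϖ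
    have hspan : Ideal.span {algebraMap R A r} = IsLocalRing.maximalIdeal A := by
      rw [hϖ.maximalIdeal_eq, ← IsLocalization.mk'_spec A r t]
      exact Ideal.span_singleton_mul_right_unit (IsLocalization.map_units A t) _
    have hr : algebraMap R K r ≠ 0 := by
      intro h
      rw [IsFractionRing.to_map_eq_zero_iff] at h
      apply hϖ.ne_zero
      rw [h, IsLocalization.mk'_zero]
    refine ⟨.ofMul (toPrincipalIdeal R K (Units.mk0 _ hr)), ?_⟩
    have hext : extendedHom L A (spanSingleton R⁰ (algebraMap R K r)) =
        ((IsDiscreteValuationRing.maximalIdeal A).asIdeal : FractionalIdeal A⁰ L) := by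
      rw [← coeIdeal_span_singleton, extendedHom_coeIdeal_eq_map, Ideal.map_span,
        Set.image_singleton, hspan]
      rfl
    change count L _ (extendedHom L A (toPrincipalIdeal R K (Units.mk0 _ hr) :
      FractionalIdeal R⁰ K)) = 1
    rw [coe_toPrincipalIdeal, Units.val_mk0, hext, count_self]

end FractionalIdeal

open nonZeroDivisors FractionalIdeal in
/-- The group of invertible fractional ideals is free as soon as it has, at every maximal ideal,
a surjective integer-valued order function. -/
lemma free_units_fractionalIdeal {R K : Type*} [CommRing R] [IsDomain R] [Field K] [Algebra R K]
    [IsFractionRing R K] (v : MaximalSpectrum R → Additive (FractionalIdeal R⁰ K)ˣ →+ ℤ)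
    (hv : ∀ M (C : (FractionalIdeal R⁰ K)ˣ), v M (.ofMul C) ≤ 0 ↔
      ∃ s ∉ M.asIdeal, algebraMap R K s ∈ (C : FractionalIdeal R⁰ K))
    (hv1 : ∀ M, ∃ C, v M C = 1) :
    Module.Free ℤ (Additive (FractionalIdeal R⁰ K)ˣ) := by
  have hle_iff : ∀ M (I J : (FractionalIdeal R⁰ K)ˣ), v M (.ofMul I) ≤ v M (.ofMul J) ↔
      ∃ s ∉ M.asIdeal,
        algebraMap R K s ∈ ((I * J⁻¹ : (FractionalIdeal R⁰ K)ˣ) : FractionalIdeal R⁰ K) := by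
    intro M I J
    rw [← hv, ofMul_mul, ofMul_inv, map_add, map_neg, add_neg_nonpos_iff]
  have hone : ∀ C : (FractionalIdeal R⁰ K)ˣ, (∀ M, v M (.ofMul C) ≤ 0) →
      (1 : FractionalIdeal R⁰ K) ≤ C := fun C h =>
    one_le_of_forall_exists_notMem fun M => (hv M C).1 (h M)
  have hmono : ∀ M (I J : (FractionalIdeal R⁰ K)ˣ), (I : FractionalIdeal R⁰ K) ≤ J →
      v M (.ofMul J) ≤ v M (.ofMul I) := by
    intro M I J hIJ
    refine (hle_iff M J I).2 ⟨1, M.asIdeal.one_notMem, ?_⟩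
    rw [map_one, ← FractionalIdeal.one_le]
    calc (1 : FractionalIdeal R⁰ K) = I * ↑I⁻¹ := (Units.mul_inv I).symm
      _ ≤ J * ↑I⁻¹ := mul_le_mul_left hIJ _
      _ = _ := (Units.val_mul _ _).symm
  let Φ : Additive (FractionalIdeal R⁰ K)ˣ →ₗ[ℤ] (MaximalSpectrum R → ℤ) :=
    LinearMap.pi fun M => (v M).toIntLinearMap
  have hle : ∀ I J : (FractionalIdeal R⁰ K)ˣ, Φ (.ofMul I) ≤ Φ (.ofMul J) →
      (J : FractionalIdeal R⁰ K) ≤ I := by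
    intro I J h
    have h1 := hone (I * J⁻¹) fun M => (hv M _).2 ((hle_iff M I J).1 (h M))
    calc (J : FractionalIdeal R⁰ K) = 1 * J := (one_mul _).symm
      _ ≤ _ * J := mul_le_mul_left h1 _
      _ = I := by rw [← Units.val_mul, inv_mul_cancel_right]
  have hinj : Function.Injective Φ := fun I J h =>
    Additive.toMul.injective (Units.ext (le_antisymm (hle J.toMul I.toMul h.ge)
      (hle I.toMul J.toMul h.le)))
  have hG : IsCompactIntLattice (LinearMap.range Φ) := by
    refine ⟨?_, ?_, ?_, ?_⟩
    · rintro _ ⟨I, rfl⟩ _ ⟨J, rfl⟩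
      obtain ⟨S, hS⟩ := isUnit_add_of_locally_comparable I.toMul J.toMul fun M => by
        rcases le_total (v M I) (v M J) with h | h
        · obtain ⟨s, hs, h⟩ := (hle_iff M I.toMul J.toMul).1 h
          exact ⟨s, hs, .inl h⟩
        · obtain ⟨s, hs, h⟩ := (hle_iff M J.toMul I.toMul).1 h
          exact ⟨s, hs, .inr h⟩
      rw [← sup_eq_add] at hS
      refine ⟨.ofMul S, funext fun M => le_antisymm (le_inf ?_ ?_) ?_⟩
      · exact hmono M I.toMul S (hS ▸ le_sup_left)
      · exact hmono M J.toMul S (hS ▸ le_sup_right)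
      · rcases le_total (v M I) (v M J) with h | h
        · obtain ⟨s, hs, h⟩ := (hle_iff M I.toMul J.toMul).1 h
          exact inf_le_left.trans
            ((hle_iff M I.toMul S).2 ⟨s, hs, mem_mul_inv_of_eq_sup hS h⟩)
        · obtain ⟨s, hs, h⟩ := (hle_iff M J.toMul I.toMul).1 h
          exact inf_le_right.trans
            ((hle_iff M J.toMul S).2 ⟨s, hs, mem_mul_inv_of_eq_sup (hS.trans (sup_comm _ _)) h⟩)
    · intro M
      obtain ⟨C, hC⟩ := hv1 M
      exact ⟨_, ⟨C, rfl⟩, hC⟩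
    · intro M N hMN
      obtain ⟨x, hxM, hxN⟩ : ∃ x ∈ M.asIdeal, x ∉ N.asIdeal := by
        by_contra! h
        exact hMN (MaximalSpectrum.ext (M.isMaximal.eq_of_le N.isMaximal.ne_top h))
      have hx0 : algebraMap R K x ≠ 0 := by
        intro h
        rw [IsFractionRing.to_map_eq_zero_iff] at h
        exact hxN (h ▸ N.asIdeal.zero_mem)
      refine ⟨_, ⟨.ofMul (toPrincipalIdeal R K (Units.mk0 _ hx0)), rfl⟩, fun h => ?_,
        le_antisymm ?_ ?_⟩
      · obtain ⟨s, hs, hsx⟩ := (hv M _).1 h.le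
        rw [coe_toPrincipalIdeal, Units.val_mk0, mem_spanSingleton] at hsx
        obtain ⟨r, hr⟩ := hsx
        rw [Algebra.smul_def, ← map_mul] at hr
        exact hs (IsFractionRing.injective R K hr ▸ M.asIdeal.mul_mem_left r hxM)
      · refine (hv N _).2 ⟨x, hxN, ?_⟩
        rw [coe_toPrincipalIdeal, Units.val_mk0]
        exact mem_spanSingleton_self _ _
      · have h := hmono N (toPrincipalIdeal R K (Units.mk0 _ hx0)) 1 (by
          rw [coe_toPrincipalIdeal, Units.val_mk0, Units.val_one, spanSingleton_le_iff_mem]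
          exact coe_mem_one _ x)
        rwa [ofMul_one, map_zero] at h
    · intro S hSG hne hdir hpos
      let T : Set (FractionalIdeal R⁰ K)ˣ := {C | Φ (.ofMul C) ∈ S}
      have hlift : ∀ f ∈ S, ∃ C : T, Φ (.ofMul C) = f := by
        intro f hf
        obtain ⟨C, rfl⟩ := hSG hf
        exact ⟨⟨C.toMul, hf⟩, rfl⟩
      have : Nonempty T := let ⟨f, hf⟩ := hne; let ⟨C, _⟩ := hlift f hf; ⟨C⟩
      let 𝔞 : T → Ideal R := fun C =>
        Submodule.comap (Algebra.linearMap R K) C.1.1.coeToSubmodule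
      have hdir' : Directed (· ≤ ·) 𝔞 := by
        intro C D
        obtain ⟨k, hk, hkC, hkD⟩ := hdir _ C.2 _ D.2
        obtain ⟨E, rfl⟩ := hlift k hk
        exact ⟨E, Submodule.comap_mono (hle E C hkC), Submodule.comap_mono (hle E D hkD)⟩
      have hproper : (⨆ C, 𝔞 C) ≠ ⊤ := by
        rw [Ne, Ideal.eq_top_iff_one, Submodule.mem_iSup_of_directed _ hdir']
        rintro ⟨C, hC⟩
        rw [Submodule.mem_comap, Algebra.linearMap_apply, map_one] at hC
        refine (hpos _ C.2).2 (le_antisymm (fun M => ?_) (hpos _ C.2).1)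
        exact (hv M C).2 ⟨1, M.asIdeal.one_notMem, by rwa [map_one]⟩
      obtain ⟨M, hM, hMle⟩ := Ideal.exists_le_maximal _ hproper
      refine ⟨⟨M, hM⟩, fun f hf h0 => ?_⟩
      obtain ⟨C, rfl⟩ := hlift f hf
      obtain ⟨s, hs, hsC⟩ := (hv ⟨M, hM⟩ C).1 h0.le
      exact hs (hMle (Submodule.mem_iSup_of_mem C hsC))
  have := hG.free
  exact Module.Free.of_equiv (LinearEquiv.ofInjective Φ hinj).symm

/-- For every almost Dedekind domain `D`, the group `Inv(D)` of invertible
fractional ideals of `D` is a free abelian group. -/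
theorem statement19 (R : Type*) [CommRing R] [IsDomain R] (hAD : AlmostDedekind R) :
    Module.Free ℤ
      (Additive (FractionalIdeal (nonZeroDivisors R) (FractionRing R))ˣ) := by
  have hloc : ∀ M : MaximalSpectrum R, _ := fun M =>
    have := hAD M
    exists_localOrder (K := FractionRing R) M (Localization.AtPrime M.asIdeal)
  choose v hv hv1 using hloc
  exact free_units_fractionalIdeal v hv hv1

end ADPaper
end
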